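/- Let μ and ν be Borel probability measures on ℝ^m and ℝ^n respectively, with finite fourth moments (∫‖x‖⁴ dμ(x) < ∞ and ∫‖y‖⁴ dν(y) < ∞). Then the supremum over P ∈ F_{m,n} and couplings π ∈ Π(μ, ν) of ∫ ⟨P x, y⟩ dπ(x, y) equals the negative of the infimum over P ∈ F_{m,n} of the supremum over measurable ν-integrable f : ℝ^n → ℝ of the infimum over measurable T : ℝ^m → ℝ^n of L(P, f, T). -/

import Mathlib

open MeasureTheory Matrix

noncomputable section

/-- `L(P, f, T) = ∫ f dν − ∫ [⟨P x, T x⟩ + f (T x)] dμ`. -/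
def L {m n : ℕ} (μ : Measure (Fin m → ℝ)) (ν : Measure (Fin n → ℝ))
    (P : Matrix (Fin n) (Fin m) ℝ) (f : (Fin n → ℝ) → ℝ)
    (T : (Fin m → ℝ) → (Fin n → ℝ)) : ℝ :=
  (∫ y, f y ∂ν) - ∫ x, (P.mulVec x ⬝ᵥ T x + f (T x)) ∂μ

/-- `F_{m,n}`: matrices in `ℝ^{n×m}` of Frobenius norm `min(√m, √n)`. -/
def Fset (m n : ℕ) : Set (Matrix (Fin n) (Fin m) ℝ) :=
  {P | Real.sqrt (∑ i, ∑ j, (P i j) ^ 2) = min (Real.sqrt m) (Real.sqrt n)}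

/-- `π` is a coupling of `μ` and `ν`. -/
def IsCoupling {m n : ℕ} (π : Measure ((Fin m → ℝ) × (Fin n → ℝ)))
    (μ : Measure (Fin m → ℝ)) (ν : Measure (Fin n → ℝ)) : Prop :=
  IsProbabilityMeasure π ∧ π.map Prod.fst = μ ∧ π.map Prod.snd = ν

/-- `Φ(P) = sup over measurable ν-integrable f of (inf over measurable T of L(P, f, T))`. -/
def Phi {m n : ℕ} (μ : Measure (Fin m → ℝ)) (ν : Measure (Fin n → ℝ))
    (P : Matrix (Fin n) (Fin m) ℝ) : EReal :=
  ⨆ f : {f : (Fin n → ℝ) → ℝ // Measurable f ∧ Integrable f ν},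
    ⨅ T : {T : (Fin m → ℝ) → (Fin n → ℝ) // Measurable T}, (L μ ν P f.1 T.1 : EReal)

section Duality

open Filter Topology Pointwise CompactlySupported

/-- `r` is the cost of a separable majorant of `h`: there are integrable `φ`, `ψ` with
`h (x, y) ≤ φ x + ψ y` and `∫ φ dμ + ∫ ψ dν = r`. -/
def IsMajorantCost {X Y : Type*} [MeasurableSpace X] [MeasurableSpace Y]
    (μ : Measure X) (ν : Measure Y) (h : X × Y → ℝ) (r : ℝ) : Prop :=
  ∃ (φ : X → ℝ) (ψ : Y → ℝ), Measurable φ ∧ Integrable φ μ ∧ Measurable ψ ∧ Integrable ψ ν ∧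
    (∀ x y, h (x, y) ≤ φ x + ψ y) ∧ (∫ x, φ x ∂μ) + ∫ y, ψ y ∂ν = r

variable {X Y : Type*} [MeasurableSpace X] [MeasurableSpace Y] {μ : Measure X} {ν : Measure Y}

lemma IsMajorantCost.add {h g : X × Y → ℝ} {r s : ℝ} (hr : IsMajorantCost μ ν h r)
    (hs : IsMajorantCost μ ν g s) : IsMajorantCost μ ν (h + g) (r + s) := by
  obtain ⟨φ, ψ, hφ, hφi, hψ, hψi, hle, rfl⟩ := hr
  obtain ⟨φ', ψ', hφ', hφi', hψ', hψi', hle', rfl⟩ := hs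
  refine ⟨φ + φ', ψ + ψ', hφ.add hφ', hφi.add hφi', hψ.add hψ', hψi.add hψi', fun x y => ?_, ?_⟩
  · have := hle x y
    have := hle' x y
    simp only [Pi.add_apply]
    linarith
  · simp only [Pi.add_apply]
    rw [integral_add hφi hφi', integral_add hψi hψi']
    ring

lemma IsMajorantCost.smul {h : X × Y → ℝ} {r t : ℝ} (ht : 0 ≤ t)
    (hr : IsMajorantCost μ ν h r) : IsMajorantCost μ ν (t • h) (t * r) := by
  obtain ⟨φ, ψ, hφ, hφi, hψ, hψi, hle, rfl⟩ := hr
  refine ⟨t • φ, t • ψ, hφ.const_smul t, hφi.smul t, hψ.const_smul t, hψi.smul t,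
    fun x y => ?_, ?_⟩
  · have := mul_le_mul_of_nonneg_left (hle x y) ht
    simp only [Pi.smul_apply, smul_eq_mul]
    linarith
  · simp only [Pi.smul_apply, smul_eq_mul, integral_const_mul]
    ring

lemma IsMajorantCost.mono {h g : X × Y → ℝ} {r : ℝ} (hr : IsMajorantCost μ ν h r)
    (hg : ∀ z, g z ≤ h z) : IsMajorantCost μ ν g r := by
  obtain ⟨φ, ψ, hφ, hφi, hψ, hψi, hle, hr⟩ := hr
  exact ⟨φ, ψ, hφ, hφi, hψ, hψi, fun x y => (hg _).trans (hle x y), hr⟩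

lemma IsMajorantCost.nonneg [IsProbabilityMeasure μ] [IsProbabilityMeasure ν]
    {h : X × Y → ℝ} {r : ℝ} (hr : IsMajorantCost μ ν h r) (hh : ∀ z, 0 ≤ h z) : 0 ≤ r := by
  obtain ⟨φ, ψ, hφ, hφi, hψ, hψi, hle, rfl⟩ := hr
  have key : ∀ x, 0 ≤ φ x + ∫ y, ψ y ∂ν := by
    intro x
    have h1 : 0 ≤ ∫ y, (φ x + ψ y) ∂ν :=
      integral_nonneg fun y => (hh (x, y)).trans (hle x y)
    rw [integral_add (integrable_const _) hψi] at h1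
    simpa using h1
  have h2 : 0 ≤ ∫ x, (φ x + ∫ y, ψ y ∂ν) ∂μ := integral_nonneg key
  rw [integral_add hφi (integrable_const _)] at h2
  simpa using h2

lemma isMajorantCost_const [IsProbabilityMeasure μ] [IsProbabilityMeasure ν] (C : ℝ) :
    IsMajorantCost μ ν (fun _ => C) C :=
  ⟨fun _ => C, fun _ => 0, measurable_const, integrable_const _, measurable_const,
    integrable_const _, fun _ _ => by simp, by simp⟩

variable (μ ν) in
/-- Functions dominated in absolute value by a separable integrable function. -/
def dominatedSpace : Submodule ℝ (X × Y → ℝ) where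
  carrier := {h | ∃ r, IsMajorantCost μ ν (fun z => |h z|) r}
  zero_mem' := ⟨_, fun _ => 0, fun _ => 0, measurable_const, integrable_zero _ _ _,
    measurable_const, integrable_zero _ _ _, fun _ _ => by simp, rfl⟩
  add_mem' := by
    rintro h g ⟨r, hr⟩ ⟨s, hs⟩
    exact ⟨r + s, (hr.add hs).mono fun z => abs_add_le _ _⟩
  smul_mem' := by
    rintro t h ⟨r, hr⟩
    exact ⟨|t| * r, (hr.smul (abs_nonneg t)).mono fun z => by simp [abs_mul]⟩

/-- Every sublinear functional is touched at any given point by a linear functional below it. -/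
lemma exists_linear_le_sublinear {E : Type*} [AddCommGroup E] [Module ℝ E] (N : E → ℝ)
    (N_hom : ∀ c : ℝ, 0 < c → ∀ x, N (c • x) = c * N x) (N_add : ∀ x y, N (x + y) ≤ N x + N y)
    (x₀ : E) : ∃ g : E →ₗ[ℝ] ℝ, g x₀ = N x₀ ∧ ∀ x, g x ≤ N x := by
  have N_zero : N 0 = 0 := by
    have := N_hom 2 (by norm_num) 0
    rw [smul_zero] at this
    linarith
  have hx₀ : ∀ t : ℝ, t • x₀ = 0 → (RingHom.id ℝ) t • N x₀ = 0 := by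
    intro t ht
    rcases smul_eq_zero.1 ht with rfl | rfl <;> simp [N_zero]
  obtain ⟨g, hg₀, hg⟩ := exists_extension_of_le_sublinear
    (LinearPMap.mkSpanSingleton' x₀ (N x₀) hx₀ : E →ₗ.[ℝ] ℝ) N N_hom N_add (by
    rintro ⟨x, hx⟩
    obtain ⟨t, rfl⟩ := Submodule.mem_span_singleton.1 hx
    rw [LinearPMap.mkSpanSingleton'_apply]
    simp only [RingHom.id_apply, smul_eq_mul]
    rcases lt_trichotomy t 0 with ht | rfl | ht
    · have h1 := N_add (t • x₀) ((-t) • x₀)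
      rw [← add_smul, add_neg_cancel, zero_smul, N_zero, N_hom (-t) (by linarith)] at h1
      linarith
    · simp [N_zero]
    · simp [N_hom t ht])
  refine ⟨g, ?_, hg⟩
  have := hg₀ ⟨x₀, Submodule.mem_span_singleton_self x₀⟩
  exact this.trans (LinearPMap.mkSpanSingleton'_apply_self _ _ _ _)

variable (μ ν) in
/-- The infimum of the costs of the separable majorants of `h`. -/
def majorantInf (h : X × Y → ℝ) : ℝ := sInf {r | IsMajorantCost μ ν h r}

lemma nonempty_majorantCost {h : X × Y → ℝ} (hh : h ∈ dominatedSpace μ ν) :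
    {r | IsMajorantCost μ ν h r}.Nonempty := by
  obtain ⟨r, hr⟩ := hh
  exact ⟨r, hr.mono fun z => le_abs_self _⟩

lemma bddBelow_majorantCost [IsProbabilityMeasure μ] [IsProbabilityMeasure ν] {h : X × Y → ℝ}
    (hh : h ∈ dominatedSpace μ ν) : BddBelow {r | IsMajorantCost μ ν h r} := by
  obtain ⟨r, hr⟩ := hh
  refine ⟨-r, fun s hs => ?_⟩
  have := (IsMajorantCost.add hs hr).nonneg (fun z => by
    have := neg_abs_le (h z)
    simp only [Pi.add_apply]
    linarith)
  linarith

lemma majorantInf_smul {t : ℝ} (ht : 0 < t) (h : X × Y → ℝ) :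
    majorantInf μ ν (t • h) = t * majorantInf μ ν h := by
  have : {r | IsMajorantCost μ ν (t • h) r} = t • {r | IsMajorantCost μ ν h r} := by
    ext r
    rw [Set.mem_smul_set_iff_inv_smul_mem₀ ht.ne']
    constructor
    · intro hr
      have := IsMajorantCost.smul (inv_nonneg.2 ht.le) hr
      rwa [inv_smul_smul₀ ht.ne'] at this
    · intro hr
      have := IsMajorantCost.smul ht.le hr
      rwa [smul_eq_mul, mul_inv_cancel_left₀ ht.ne'] at this
  rw [majorantInf, this, Real.sInf_smul_of_nonneg ht.le, smul_eq_mul, majorantInf]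

lemma majorantInf_add_le [IsProbabilityMeasure μ] [IsProbabilityMeasure ν] {h g : X × Y → ℝ}
    (hh : h ∈ dominatedSpace μ ν) (hg : g ∈ dominatedSpace μ ν) :
    majorantInf μ ν (h + g) ≤ majorantInf μ ν h + majorantInf μ ν g := by
  unfold majorantInf
  rw [← csInf_add (nonempty_majorantCost hh) (bddBelow_majorantCost hh)
    (nonempty_majorantCost hg) (bddBelow_majorantCost hg)]
  refine csInf_le_csInf (bddBelow_majorantCost (add_mem hh hg))
    ((nonempty_majorantCost hh).add (nonempty_majorantCost hg)) ?_
  rintro _ ⟨r, hr, s, hs, rfl⟩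
  exact IsMajorantCost.add hr hs

/-- A linear functional dominated by all majorant costs and approximated by them at `c`. -/
lemma exists_functional_le_majorantCost [IsProbabilityMeasure μ] [IsProbabilityMeasure ν]
    (c : dominatedSpace μ ν) :
    ∃ Λ : dominatedSpace μ ν →ₗ[ℝ] ℝ,
      (∀ (h : dominatedSpace μ ν) (r : ℝ), IsMajorantCost μ ν h r → Λ h ≤ r) ∧
      ∀ ε > 0, ∃ r, IsMajorantCost μ ν c r ∧ r < Λ c + ε := by
  obtain ⟨Λ, hΛc, hΛ⟩ := exists_linear_le_sublinear
    (fun h : dominatedSpace μ ν => majorantInf μ ν h) (fun t ht h => majorantInf_smul ht h.1)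
    (fun h g => majorantInf_add_le h.2 g.2) c
  refine ⟨Λ, fun h r hr => (hΛ h).trans (csInf_le (bddBelow_majorantCost h.2) hr),
    fun ε hε => ?_⟩
  obtain ⟨r, hr, hlt⟩ := exists_lt_of_csInf_lt (nonempty_majorantCost c.2)
    (lt_add_of_pos_right (majorantInf μ ν c) hε)
  exact ⟨r, hr, by rw [hΛc]; exact hlt⟩

lemma CompactlySupportedContinuousMap.mem_dominatedSpace [TopologicalSpace X]
    [TopologicalSpace Y] [IsProbabilityMeasure μ]
    [IsProbabilityMeasure ν] (f : C_c(X × Y, ℝ)) : (f : X × Y → ℝ) ∈ dominatedSpace μ ν := by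
  obtain ⟨C, hC⟩ := f.hasCompactSupport.exists_bound_of_continuous f.continuous
  exact ⟨C, (isMajorantCost_const C).mono hC⟩

/-- Two probability measures are equal once one is below the other on nonnegative bounded
continuous functions. -/
lemma eq_of_forall_integral_le_of_isProbabilityMeasure [TopologicalSpace X]
    [BorelSpace X] [HasOuterApproxClosed X]
    {ρ : Measure X} [IsProbabilityMeasure ρ] [IsProbabilityMeasure μ]
    (h : ∀ f : BoundedContinuousFunction X ℝ, (∀ x, 0 ≤ f x) → ∫ x, f x ∂ρ ≤ ∫ x, f x ∂μ) :
    ρ = μ := by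
  refine ext_of_forall_integral_eq_of_IsFiniteMeasure fun f => le_antisymm ?_ ?_
  · have := h (f + BoundedContinuousFunction.const X ‖f‖) fun x => by
      have := (abs_le.1 (f.norm_coe_le_norm x)).1
      simp only [BoundedContinuousFunction.coe_add, Pi.add_apply,
        BoundedContinuousFunction.const_apply]
      linarith
    simp only [BoundedContinuousFunction.coe_add, Pi.add_apply,
      BoundedContinuousFunction.const_apply] at this
    rw [integral_add (f.integrable ρ) (integrable_const _),
      integral_add (f.integrable μ) (integrable_const _)] at this
    simpa using this
  · have := h (BoundedContinuousFunction.const X ‖f‖ - f) fun x => by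
      have := (abs_le.1 (f.norm_coe_le_norm x)).2
      simp only [BoundedContinuousFunction.coe_sub, Pi.sub_apply,
        BoundedContinuousFunction.const_apply]
      linarith
    simp only [BoundedContinuousFunction.coe_sub, Pi.sub_apply,
      BoundedContinuousFunction.const_apply] at this
    rw [integral_sub (integrable_const _) (f.integrable ρ),
      integral_sub (integrable_const _) (f.integrable μ)] at this
    simp only [integral_const, probReal_univ, one_smul] at this
    linarith

variable [TopologicalSpace X] [T2Space X] [LocallyCompactSpace X] [SecondCountableTopology X]
  [BorelSpace X] [TopologicalSpace Y] [T2Space Y] [LocallyCompactSpace Y]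
  [SecondCountableTopology Y] [BorelSpace Y]

/-- A sequence of compactly supported cutoffs exhausting the space. -/
lemma exists_seq_cutoff (Z : Type*) [TopologicalSpace Z] [T2Space Z] [LocallyCompactSpace Z]
    [SigmaCompactSpace Z] :
    ∃ χ : ℕ → C_c(Z, ℝ), (∀ n z, χ n z ∈ Set.Icc (0 : ℝ) 1) ∧
      ∀ z, ∀ᶠ n in atTop, χ n z = 1 := by
  set K := CompactExhaustion.choice Z
  have : ∀ n, ∃ f : C_c(Z, ℝ), (∀ z, f z ∈ Set.Icc (0 : ℝ) 1) ∧ ∀ z ∈ K n, f z = 1 := by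
    intro n
    obtain ⟨f, hf1, -, hfc, hf⟩ :=
      exists_continuous_one_zero_of_isCompact (K.isCompact n) isClosed_empty (Set.disjoint_empty _)
    exact ⟨⟨f, hfc⟩, hf, fun z hz => hf1 hz⟩
  choose χ hχ hχ1 using this
  refine ⟨χ, hχ, fun z => ?_⟩
  filter_upwards [eventually_ge_atTop (K.find z)] with n hn
  exact hχ1 n z (K.subset hn (K.mem_find z))

/-- The Riesz measure of a positive functional does not charge nonnegative continuous functions
more than the functional does. -/
lemma integrable_and_integral_le_of_eq_on_compactSupport [IsProbabilityMeasure μ]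
    [IsProbabilityMeasure ν] {Λ : dominatedSpace μ ν →ₗ[ℝ] ℝ}
    (hΛ : ∀ (h : dominatedSpace μ ν) (r : ℝ), IsMajorantCost μ ν h r → Λ h ≤ r)
    {π : Measure (X × Y)} [IsFiniteMeasureOnCompacts π]
    (hπ : ∀ f : C_c(X × Y, ℝ), ∫ z, f z ∂π = Λ ⟨f, f.mem_dominatedSpace⟩)
    (h : dominatedSpace μ ν) (hc : Continuous (h : X × Y → ℝ)) (h0 : ∀ z, 0 ≤ (h : X × Y → ℝ) z) :
    Integrable (h : X × Y → ℝ) π ∧ ∫ z, (h : X × Y → ℝ) z ∂π ≤ Λ h := by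
  have hmono : ∀ f g : dominatedSpace μ ν, (∀ z, (f : X × Y → ℝ) z ≤ (g : X × Y → ℝ) z) →
      Λ f ≤ Λ g := by
    intro f g hfg
    have := hΛ (f - g) 0 ((isMajorantCost_const 0).mono fun z => by simpa using hfg z)
    rw [map_sub] at this
    linarith
  have hΛ0 : 0 ≤ Λ h := by
    simpa using hmono 0 h (fun z => by simpa using h0 z)
  obtain ⟨χ, hχ, hχ1⟩ := exists_seq_cutoff (X × Y)
  let F : ℕ → C_c(X × Y, ℝ) := fun n =>
    ⟨⟨fun z => h.1 z * χ n z, hc.mul (χ n).continuous⟩, (χ n).hasCompactSupport.mul_left⟩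
  have hF : ∀ n z, F n z = h.1 z * χ n z := fun n z => rfl
  have hF0 : ∀ n z, 0 ≤ F n z := fun n z => mul_nonneg (h0 z) (hχ n z).1
  have hFint : ∀ n, ∫⁻ z, ENNReal.ofReal (F n z) ∂π ≤ ENNReal.ofReal (Λ h) := by
    intro n
    rw [← ofReal_integral_eq_lintegral_ofReal (F n).integrable (ae_of_all _ (hF0 n)), hπ]
    refine ENNReal.ofReal_le_ofReal (hmono _ _ fun z => ?_)
    exact mul_le_of_le_one_right (h0 z) (hχ n z).2
  have hlint : ∫⁻ z, ENNReal.ofReal (h.1 z) ∂π ≤ ENNReal.ofReal (Λ h) := by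
    calc ∫⁻ z, ENNReal.ofReal (h.1 z) ∂π
        = ∫⁻ z, liminf (fun n => ENNReal.ofReal (F n z)) atTop ∂π := by
          refine lintegral_congr fun z => (Tendsto.liminf_eq ?_).symm
          refine tendsto_const_nhds.congr' ?_
          filter_upwards [hχ1 z] with n hn
          rw [hF, hn, mul_one]
      _ ≤ liminf (fun n => ∫⁻ z, ENNReal.ofReal (F n z) ∂π) atTop :=
          lintegral_liminf_le fun n => (F n).continuous.measurable.ennreal_ofReal
      _ ≤ ENNReal.ofReal (Λ h) := by
          refine liminf_le_of_le (by isBoundedDefault) fun b hb => ?_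
          obtain ⟨n, hn⟩ := hb.exists
          exact hn.trans (hFint n)
  refine ⟨⟨hc.measurable.aestronglyMeasurable, ?_⟩, ?_⟩
  · rw [hasFiniteIntegral_iff_ofReal (ae_of_all _ h0)]
    exact hlint.trans_lt ENNReal.ofReal_lt_top
  · rw [integral_eq_lintegral_of_nonneg_ae (ae_of_all _ h0) hc.measurable.aestronglyMeasurable]
    exact ENNReal.toReal_le_of_le_ofReal hΛ0 hlint

/-- In a σ-compact space the complement of some compact set has small mass. -/
lemma exists_isCompact_integral_indicator_compl_lt {Z : Type*} [TopologicalSpace Z] [T2Space Z]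
    [LocallyCompactSpace Z] [SigmaCompactSpace Z] [MeasurableSpace Z] [BorelSpace Z]
    (ρ : Measure Z) [IsProbabilityMeasure ρ] {ε : ℝ} (hε : 0 < ε) :
    ∃ K : Set Z, IsCompact K ∧ ∫ z, Kᶜ.indicator (fun _ => (1 : ℝ)) z ∂ρ < ε := by
  set K := CompactExhaustion.choice Z
  have h1 : Tendsto (fun n => ρ.real (K n)) atTop (𝓝 1) := by
    have := tendsto_measure_iUnion_atTop (μ := ρ) (s := K) (fun a b h => K.subset h)
    rw [K.iUnion_eq, measure_univ] at this
    exact (ENNReal.tendsto_toReal ENNReal.one_ne_top).comp this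
  obtain ⟨n, hn⟩ := (h1.eventually (lt_mem_nhds (by linarith : 1 - ε < 1))).exists
  refine ⟨K n, K.isCompact n, ?_⟩
  rw [integral_indicator (K.isCompact n).measurableSet.compl]
  simp only [integral_const, MeasurableSet.univ, measureReal_restrict_apply, Set.univ_inter,
    smul_eq_mul, mul_one]
  rw [probReal_compl_eq_one_sub (K.isCompact n).measurableSet]
  linarith

/-- A positive functional with the marginals `μ` and `ν` gives a measure of mass at least one. -/
lemma one_le_measureReal_univ_of_eq_on_compactSupport [IsProbabilityMeasure μ]
    [IsProbabilityMeasure ν] {Λ : dominatedSpace μ ν →ₗ[ℝ] ℝ}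
    (hΛ : ∀ (h : dominatedSpace μ ν) (r : ℝ), IsMajorantCost μ ν h r → Λ h ≤ r)
    {π : Measure (X × Y)} [IsFiniteMeasure π]
    (hπ : ∀ f : C_c(X × Y, ℝ), ∫ z, f z ∂π = Λ ⟨f, f.mem_dominatedSpace⟩) :
    1 ≤ π.real Set.univ := by
  refine le_of_forall_pos_le_add fun ε hε => ?_
  obtain ⟨K, hK, hKε⟩ := exists_isCompact_integral_indicator_compl_lt μ (half_pos hε)
  obtain ⟨K', hK', hKε'⟩ := exists_isCompact_integral_indicator_compl_lt ν (half_pos hε)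
  obtain ⟨f, hf1, -, hfc, hf⟩ := exists_continuous_one_zero_of_isCompact (hK.prod hK')
    isClosed_empty (Set.disjoint_empty _)
  let F : C_c(X × Y, ℝ) := ⟨f, hfc⟩
  have hF : IsMajorantCost μ ν (-(F : X × Y → ℝ))
      ((∫ x, (Kᶜ.indicator (fun _ => (1 : ℝ)) x - 1) ∂μ) +
        ∫ y, K'ᶜ.indicator (fun _ => (1 : ℝ)) y ∂ν) := by
    have hm : Measurable (Kᶜ.indicator (fun _ => (1 : ℝ))) :=
      measurable_const.indicator hK.measurableSet.compl
    have hi : Integrable (Kᶜ.indicator (fun _ => (1 : ℝ))) μ :=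
      (integrable_const _).indicator hK.measurableSet.compl
    refine ⟨_, _, hm.sub_const 1, hi.sub (integrable_const 1),
      measurable_const.indicator hK'.measurableSet.compl,
      (integrable_const _).indicator hK'.measurableSet.compl, fun x y => ?_, rfl⟩
    have hpos : 0 ≤ F (x, y) := (hf (x, y)).1
    by_cases hx : x ∈ K <;> by_cases hy : y ∈ K'
    · have : F (x, y) = 1 := hf1 (Set.mk_mem_prod hx hy)
      simp [hx, hy, this]
    all_goals simp [hx, hy]; try linarith
  have h1 := hΛ (-⟨F, F.mem_dominatedSpace⟩) _ hF
  rw [map_neg, ← hπ, integral_sub ((integrable_const _).indicator hK.measurableSet.compl)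
    (integrable_const _)] at h1
  simp only [integral_const, probReal_univ, smul_eq_mul, mul_one] at h1
  have h2 : ∫ z, F z ∂π ≤ ∫ _, (1 : ℝ) ∂π :=
    integral_mono F.integrable (integrable_const _) fun z => (hf z).2
  simp only [integral_const, smul_eq_mul, mul_one] at h2
  linarith

/-- **Kantorovich duality** for a continuous reward `c` with `|c| ≤ a ⊕ b`: some coupling is
at least as good as the infimum of the dual problem. -/
theorem exists_coupling_forall_exists_majorantCost_lt [HasOuterApproxClosed X]
    [HasOuterApproxClosed Y] [IsProbabilityMeasure μ] [IsProbabilityMeasure ν] {c : X × Y → ℝ}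
    (hc : Continuous c) {a : X → ℝ} {b : Y → ℝ} (ha : Continuous a) (hb : Continuous b)
    (hai : Integrable a μ) (hbi : Integrable b ν) (hcab : ∀ x y, |c (x, y)| ≤ a x + b y) :
    ∃ π : Measure (X × Y), IsProbabilityMeasure π ∧ π.map Prod.fst = μ ∧ π.map Prod.snd = ν ∧
      ∀ ε > 0, ∃ r, IsMajorantCost μ ν c r ∧ r < (∫ z, c z ∂π) + ε := by
  have hcE : c ∈ dominatedSpace μ ν :=
    ⟨_, a, b, ha.measurable, hai, hb.measurable, hbi, hcab, rfl⟩
  obtain ⟨Λ, hΛ, hΛc⟩ := exists_functional_le_majorantCost ⟨c, hcE⟩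
  let Λ₀ : C_c(X × Y, ℝ) →ₗ[ℝ] ℝ :=
    { toFun := fun f => Λ ⟨f, f.mem_dominatedSpace⟩
      map_add' := fun f g => by rw [← map_add]; rfl
      map_smul' := fun t f => by rw [RingHom.id_apply, ← map_smul]; rfl }
  let Λ₁ : C_c(X × Y, ℝ) →ₚ[ℝ] ℝ := PositiveLinearMap.mk₀ Λ₀ (fun f hf => by
    have h := hΛ (-⟨f, f.mem_dominatedSpace⟩) 0
      ((isMajorantCost_const 0).mono fun z => by simpa using hf z)
    rw [map_neg] at h
    change 0 ≤ Λ ⟨f, f.mem_dominatedSpace⟩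
    linarith)
  set π := RealRMK.rieszMeasure Λ₁ with hπdef
  have hπ : ∀ f : C_c(X × Y, ℝ), ∫ z, f z ∂π = Λ ⟨f, f.mem_dominatedSpace⟩ := fun f =>
    RealRMK.integral_rieszMeasure Λ₁ f
  have hΛle : ∀ (h : X × Y → ℝ) (r : ℝ), Continuous h → (∀ z, 0 ≤ h z) →
      IsMajorantCost μ ν h r → Integrable h π ∧ ∫ z, h z ∂π ≤ r := by
    intro h r hc h0 hr
    have hh : h ∈ dominatedSpace μ ν := ⟨r, hr.mono fun z => (abs_of_nonneg (h0 z)).le⟩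
    obtain ⟨h1, h2⟩ :=
      integrable_and_integral_le_of_eq_on_compactSupport hΛ hπ ⟨h, hh⟩ hc h0
    exact ⟨h1, h2.trans (hΛ _ _ hr)⟩
  obtain ⟨hone, hone'⟩ := hΛle (fun _ => 1) 1 continuous_const (fun _ => zero_le_one)
    (isMajorantCost_const 1)
  have hfin : IsFiniteMeasure π := by
    simpa [integrable_const_iff] using hone
  have huniv : π.real Set.univ = 1 :=
    le_antisymm (by simpa using hone') (one_le_measureReal_univ_of_eq_on_compactSupport hΛ hπ)
  have hprob : IsProbabilityMeasure π := by
    refine ⟨?_⟩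
    rw [← ENNReal.toReal_eq_one_iff]
    exact huniv
  have hfst : π.map Prod.fst = μ := by
    have : IsProbabilityMeasure (π.map Prod.fst) :=
      Measure.isProbabilityMeasure_map measurable_fst.aemeasurable
    refine eq_of_forall_integral_le_of_isProbabilityMeasure fun f hf => ?_
    rw [integral_map measurable_fst.aemeasurable f.continuous.aestronglyMeasurable]
    exact (hΛle (fun z => f z.1) (∫ x, f x ∂μ) (f.continuous.comp continuous_fst)
      (fun z => hf z.1) ⟨f, fun _ => 0, f.continuous.measurable, f.integrable μ,
        measurable_const, integrable_zero _ _ _, fun _ _ => by simp, by simp⟩).2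
  have hsnd : π.map Prod.snd = ν := by
    have : IsProbabilityMeasure (π.map Prod.snd) :=
      Measure.isProbabilityMeasure_map measurable_snd.aemeasurable
    refine eq_of_forall_integral_le_of_isProbabilityMeasure fun f hf => ?_
    rw [integral_map measurable_snd.aemeasurable f.continuous.aestronglyMeasurable]
    exact (hΛle (fun z => f z.2) (∫ y, f y ∂ν) (f.continuous.comp continuous_snd)
      (fun z => hf z.2) ⟨fun _ => 0, f, measurable_const, integrable_zero _ _ _,
        f.continuous.measurable, f.integrable ν, fun _ _ => by simp, by simp⟩).2
  have haπ : Integrable (fun z : X × Y => a z.1) π := by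
    rw [← hfst] at hai
    exact hai.comp_measurable measurable_fst
  have hbπ : Integrable (fun z : X × Y => b z.2) π := by
    rw [← hsnd] at hbi
    exact hbi.comp_measurable measurable_snd
  have haint : ∫ z, a z.1 ∂π = ∫ x, a x ∂μ := by
    rw [← hfst, integral_map measurable_fst.aemeasurable ha.aestronglyMeasurable]
  have hbint : ∫ z, b z.2 ∂π = ∫ y, b y ∂ν := by
    rw [← hsnd, integral_map measurable_snd.aemeasurable hb.aestronglyMeasurable]
  have hcπ : Integrable c π := (haπ.add hbπ).mono' hc.aestronglyMeasurable
    (ae_of_all _ fun z => hcab z.1 z.2)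
  have hab : IsMajorantCost μ ν (fun z => a z.1 + b z.2) ((∫ x, a x ∂μ) + ∫ y, b y ∂ν) :=
    ⟨a, b, ha.measurable, hai, hb.measurable, hbi, fun _ _ => le_rfl, rfl⟩
  have habE : (fun z : X × Y => a z.1 + b z.2) ∈ dominatedSpace μ ν :=
    ⟨_, hab.mono fun z => (abs_of_nonneg ((abs_nonneg _).trans (hcab z.1 z.2))).le⟩
  have hle : Λ ⟨c, hcE⟩ ≤ ∫ z, c z ∂π := by
    have h1 := (integrable_and_integral_le_of_eq_on_compactSupport hΛ hπ
      (⟨_, habE⟩ - ⟨c, hcE⟩) (((ha.comp continuous_fst).add (hb.comp continuous_snd)).sub hc)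
      (fun z => sub_nonneg.2 ((le_abs_self _).trans (hcab z.1 z.2)))).2
    have h2 := hΛ ⟨_, habE⟩ _ hab
    have h3 : ∫ z, (a z.1 + b z.2 - c z) ∂π =
        (∫ x, a x ∂μ) + (∫ y, b y ∂ν) - ∫ z, c z ∂π := by
      have h5 := integral_sub (haπ.add hbπ) hcπ
      simp only [Pi.add_apply] at h5
      rw [h5, integral_add haπ hbπ, haint, hbint]
    have h4 : ∫ z, (a z.1 + b z.2 - c z) ∂π ≤ Λ (⟨_, habE⟩ - ⟨c, hcE⟩) := h1
    rw [map_sub] at h4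
    linarith
  refine ⟨π, hprob, hfst, hsnd, fun ε hε => ?_⟩
  obtain ⟨r, hr, hlt⟩ := hΛc ε hε
  exact ⟨r, hr, hlt.trans_le (by linarith)⟩

end Duality

section WeakDuality

open ProbabilityTheory unitInterval

/-- A coupling is the joint law of `(x, h x u)` with `u` uniform and independent of `x`. -/
lemma exists_measurable_map_prod_unitInterval {X Y : Type*} [MeasurableSpace X]
    [MeasurableSpace Y] [StandardBorelSpace Y] [Nonempty Y] (π : Measure (X × Y))
    [IsProbabilityMeasure π] :
    ∃ h : X → I → Y, Measurable (Function.uncurry h) ∧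
      ((π.map Prod.fst).prod (volume : Measure I)).map (fun p => (p.1, h p.1 p.2)) = π := by
  obtain ⟨h, hm, hh⟩ := Kernel.exists_measurable_map_eq_unitInterval π.condKernel
  refine ⟨h, hm, ?_⟩
  have hm' : Measurable (fun p : X × I => (p.1, h p.1 p.2)) := measurable_fst.prodMk hm
  have : IsProbabilityMeasure (π.map Prod.fst) :=
    Measure.isProbabilityMeasure_map measurable_fst.aemeasurable
  refine Measure.ext_of_lintegral _ fun f hf => ?_
  conv_rhs => rw [← π.disintegrate π.condKernel, Measure.lintegral_compProd hf]
  rw [lintegral_map hf hm', lintegral_prod (fun p : X × I => f (p.1, h p.1 p.2)) (hf.comp hm').aemeasurable]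
  refine lintegral_congr fun x => ?_
  rw [← hh x]
  exact (lintegral_map (hf.comp measurable_prodMk_left) (hm.comp measurable_prodMk_left)).symm

/-- Averaging against a coupling is at most averaging along the graph of some measurable map. -/
lemma exists_measurable_integral_le_integral_graph {X Y : Type*} [MeasurableSpace X]
    [MeasurableSpace Y] [StandardBorelSpace Y] [Nonempty Y] (π : Measure (X × Y))
    [IsProbabilityMeasure π] {g : X × Y → ℝ} (hg : Integrable g π) :
    ∃ T : X → Y, Measurable T ∧ ∫ z, g z ∂π ≤ ∫ x, g (x, T x) ∂(π.map Prod.fst) := by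
  obtain ⟨h, hm, hπ⟩ := exists_measurable_map_prod_unitInterval π
  have hm' : Measurable (fun p : X × I => (p.1, h p.1 p.2)) := measurable_fst.prodMk hm
  have : IsProbabilityMeasure (π.map Prod.fst) :=
    Measure.isProbabilityMeasure_map measurable_fst.aemeasurable
  set G : X × I → ℝ := fun p => g (p.1, h p.1 p.2) with hG
  have hgm : AEStronglyMeasurable g
      (((π.map Prod.fst).prod (volume : Measure I)).map (fun p => (p.1, h p.1 p.2))) := by
    rw [hπ]
    exact hg.1
  have hGi : Integrable G ((π.map Prod.fst).prod volume) := by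
    rw [← hπ, integrable_map_measure hgm hm'.aemeasurable] at hg
    exact hg
  have hint : ∫ z, g z ∂π = ∫ u, ∫ x, G (x, u) ∂(π.map Prod.fst) := by
    rw [← integral_prod_symm _ hGi, ← integral_map hm'.aemeasurable hgm, hπ]
  obtain ⟨u, hu⟩ := exists_integral_le hGi.integral_prod_right
  exact ⟨fun x => h x u, hm.comp measurable_prodMk_right, by rw [hint]; exact hu⟩

end WeakDuality

section Euclidean

variable {m n : ℕ}

lemma abs_dotProduct_le (u v : Fin n → ℝ) : |u ⬝ᵥ v| ≤ u ⬝ᵥ u + v ⬝ᵥ v := by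
  have h1 : 0 ≤ (u - v) ⬝ᵥ (u - v) := dotProduct_self_star_nonneg (u - v)
  have h2 : 0 ≤ (u + v) ⬝ᵥ (u + v) := dotProduct_self_star_nonneg (u + v)
  have h3 : 0 ≤ u ⬝ᵥ u := dotProduct_self_star_nonneg u
  have h4 : 0 ≤ v ⬝ᵥ v := dotProduct_self_star_nonneg v
  simp only [sub_dotProduct, dotProduct_sub, add_dotProduct, dotProduct_add,
    dotProduct_comm v u] at h1 h2
  rw [abs_le]
  constructor <;> linarith

lemma dotProduct_mulVec_self_le (P : Matrix (Fin n) (Fin m) ℝ) (x : Fin m → ℝ) :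
    P.mulVec x ⬝ᵥ P.mulVec x ≤ (∑ i, ∑ j, (P i j) ^ 2) * (x ⬝ᵥ x) := by
  have : x ⬝ᵥ x = ∑ j, x j ^ 2 := Finset.sum_congr rfl fun j _ => (sq (x j)).symm
  rw [this, Finset.sum_mul]
  refine Finset.sum_le_sum fun i _ => ?_
  rw [← sq]
  exact Finset.sum_mul_sq_le_sq_mul_sq Finset.univ (P i) x

lemma continuous_dotProduct_self : Continuous fun y : Fin n → ℝ => y ⬝ᵥ y := by
  unfold dotProduct
  fun_prop

lemma continuous_mulVec_dotProduct (P : Matrix (Fin n) (Fin m) ℝ) :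
    Continuous fun z : (Fin m → ℝ) × (Fin n → ℝ) => P.mulVec z.1 ⬝ᵥ z.2 := by
  unfold Matrix.mulVec dotProduct
  fun_prop

lemma integrable_dotProduct_self {ν : Measure (Fin n → ℝ)} [IsFiniteMeasure ν]
    (hν4 : Integrable (fun y => (y ⬝ᵥ y) ^ 2) ν) : Integrable (fun y => y ⬝ᵥ y) ν := by
  refine (hν4.add (integrable_const 1)).mono'
    continuous_dotProduct_self.aestronglyMeasurable (ae_of_all _ fun y => ?_)
  simp only [Pi.add_apply, Real.norm_eq_abs]
  rw [abs_le]
  constructor <;> nlinarith [sq_nonneg (y ⬝ᵥ y - 1), sq_nonneg (y ⬝ᵥ y + 1)]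

lemma integrable_mulVec_dotProduct_self {μ : Measure (Fin m → ℝ)} [IsFiniteMeasure μ]
    (hμ4 : Integrable (fun x => (x ⬝ᵥ x) ^ 2) μ) (P : Matrix (Fin n) (Fin m) ℝ) :
    Integrable (fun x => P.mulVec x ⬝ᵥ P.mulVec x) μ := by
  refine ((integrable_dotProduct_self hμ4).const_mul (∑ i, ∑ j, (P i j) ^ 2)).mono'
    (continuous_dotProduct_self.comp (by fun_prop)).aestronglyMeasurable
    (ae_of_all _ fun x => ?_)
  have h0 : 0 ≤ P.mulVec x ⬝ᵥ P.mulVec x := dotProduct_self_star_nonneg (P.mulVec x)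
  rw [Real.norm_of_nonneg h0]
  exact dotProduct_mulVec_self_le P x

/-- Weak duality: the inner minimax value is at most minus the value of any coupling. -/
lemma Phi_le_neg_integral_coupling {μ : Measure (Fin m → ℝ)} {ν : Measure (Fin n → ℝ)}
    [IsProbabilityMeasure μ] [IsProbabilityMeasure ν]
    (hμ4 : Integrable (fun x => (x ⬝ᵥ x) ^ 2) μ) (hν4 : Integrable (fun y => (y ⬝ᵥ y) ^ 2) ν)
    (P : Matrix (Fin n) (Fin m) ℝ) {π : Measure ((Fin m → ℝ) × (Fin n → ℝ))}
    (hπ : IsCoupling π μ ν) :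
    Phi μ ν P ≤ ((-∫ z, P.mulVec z.1 ⬝ᵥ z.2 ∂π : ℝ) : EReal) := by
  obtain ⟨hprob, hfst, hsnd⟩ := hπ
  refine iSup_le fun ⟨f, hf, hfi⟩ => ?_
  have hfπ : Integrable (fun z : (Fin m → ℝ) × (Fin n → ℝ) => f z.2) π := by
    rw [← hsnd] at hfi
    exact hfi.comp_measurable measurable_snd
  have hfint : ∫ z, f z.2 ∂π = ∫ y, f y ∂ν := by
    rw [← hsnd, integral_map measurable_snd.aemeasurable hf.aestronglyMeasurable]
  have haπ : Integrable (fun z : (Fin m → ℝ) × (Fin n → ℝ) =>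
      P.mulVec z.1 ⬝ᵥ P.mulVec z.1) π := by
    have h := integrable_mulVec_dotProduct_self hμ4 P
    rw [← hfst] at h
    exact h.comp_measurable measurable_fst
  have hbπ : Integrable (fun z : (Fin m → ℝ) × (Fin n → ℝ) => z.2 ⬝ᵥ z.2) π := by
    have h := integrable_dotProduct_self hν4
    rw [← hsnd] at h
    exact h.comp_measurable measurable_snd
  have hcπ : Integrable (fun z : (Fin m → ℝ) × (Fin n → ℝ) => P.mulVec z.1 ⬝ᵥ z.2) π :=
    (haπ.add hbπ).mono' (continuous_mulVec_dotProduct P).aestronglyMeasurable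
      (ae_of_all _ fun z => abs_dotProduct_le _ _)
  obtain ⟨T, hT, hle⟩ := exists_measurable_integral_le_integral_graph π (hcπ.add hfπ)
  refine (iInf_le _ ⟨T, hT⟩).trans (EReal.coe_le_coe_iff.2 ?_)
  simp only [Pi.add_apply] at hle
  rw [integral_add hcπ hfπ, hfint, hfst] at hle
  simp only [L]
  linarith

/-- A separable majorant of the reward of cost `r` shows that the inner minimax value is at least
`-r`. -/
lemma neg_le_Phi_of_isMajorantCost {μ : Measure (Fin m → ℝ)} {ν : Measure (Fin n → ℝ)}
    [IsProbabilityMeasure μ] [IsProbabilityMeasure ν] {P : Matrix (Fin n) (Fin m) ℝ} {r : ℝ}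
    (hr : IsMajorantCost μ ν (fun z => P.mulVec z.1 ⬝ᵥ z.2) r) :
    ((-r : ℝ) : EReal) ≤ Phi μ ν P := by
  obtain ⟨φ, ψ, hφ, hφi, hψ, hψi, hle, rfl⟩ := hr
  -- The shift by `k` makes the value `0` of a non-integrable integral harmless.
  set k : ℝ := |∫ x, φ x ∂μ| with hk
  refine le_iSup_of_le ⟨fun y => k - ψ y, measurable_const.sub hψ,
    (integrable_const k).sub hψi⟩ (le_iInf fun ⟨T, hT⟩ => EReal.coe_le_coe_iff.2 ?_)
  have hkey : ∫ x, (P.mulVec x ⬝ᵥ T x + (k - ψ (T x))) ∂μ ≤ (∫ x, φ x ∂μ) + k := by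
    by_cases hi : Integrable (fun x => P.mulVec x ⬝ᵥ T x + (k - ψ (T x))) μ
    · have h1 : ∫ x, (P.mulVec x ⬝ᵥ T x + (k - ψ (T x))) ∂μ ≤ ∫ x, (φ x + k) ∂μ :=
        integral_mono hi (hφi.add (integrable_const k)) fun x => by
          have := hle x (T x)
          simp only at this ⊢
          linarith
      rw [integral_add hφi (integrable_const k)] at h1
      simpa using h1
    · rw [integral_undef hi]
      have := neg_abs_le (∫ x, φ x ∂μ)
      linarith
  simp only [L]
  rw [integral_sub (integrable_const k) hψi]
  simp only [integral_const, probReal_univ, one_smul]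
  linarith

/-- Strong duality for a fixed matrix: some coupling attains minus the inner minimax value. -/
lemma exists_coupling_neg_integral_le_Phi {μ : Measure (Fin m → ℝ)} {ν : Measure (Fin n → ℝ)}
    [IsProbabilityMeasure μ] [IsProbabilityMeasure ν]
    (hμ4 : Integrable (fun x => (x ⬝ᵥ x) ^ 2) μ) (hν4 : Integrable (fun y => (y ⬝ᵥ y) ^ 2) ν)
    (P : Matrix (Fin n) (Fin m) ℝ) :
    ∃ π, IsCoupling π μ ν ∧
      ((-∫ z, P.mulVec z.1 ⬝ᵥ z.2 ∂π : ℝ) : EReal) ≤ Phi μ ν P := by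
  obtain ⟨π, hprob, hfst, hsnd, hπ⟩ := exists_coupling_forall_exists_majorantCost_lt
    (continuous_mulVec_dotProduct P)
    (continuous_dotProduct_self.comp (by fun_prop : Continuous fun x => P.mulVec x))
    continuous_dotProduct_self (integrable_mulVec_dotProduct_self hμ4 P)
    (integrable_dotProduct_self hν4) (fun x y => abs_dotProduct_le _ _)
  refine ⟨π, ⟨hprob, hfst, hsnd⟩, EReal.ge_of_forall_gt_iff_ge.1 fun t ht => ?_⟩
  obtain ⟨r, hr, hlt⟩ := hπ ((-∫ z, P.mulVec z.1 ⬝ᵥ z.2 ∂π) - t)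
    (sub_pos.2 (EReal.coe_lt_coe_iff.1 ht))
  exact (EReal.coe_le_coe_iff.2 (by linarith)).trans (neg_le_Phi_of_isMajorantCost hr)

end Euclidean

/-- `sup_{P ∈ F, π ∈ Π(μ,ν)} ∫ ⟨P x, y⟩ dπ = − inf_{P ∈ F} sup_f inf_T L(P, f, T)`. -/
theorem sup_coupling_eq_neg_minimax {m n : ℕ}
    (μ : Measure (Fin m → ℝ)) (ν : Measure (Fin n → ℝ))
    [IsProbabilityMeasure μ] [IsProbabilityMeasure ν]
    (hμ4 : Integrable (fun x => (x ⬝ᵥ x) ^ 2) μ)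
    (hν4 : Integrable (fun y => (y ⬝ᵥ y) ^ 2) ν) :
    (⨆ q : {q : Matrix (Fin n) (Fin m) ℝ × Measure ((Fin m → ℝ) × (Fin n → ℝ)) //
        q.1 ∈ Fset m n ∧ IsCoupling q.2 μ ν},
      ((∫ z, q.1.1.mulVec z.1 ⬝ᵥ z.2 ∂q.1.2 : ℝ) : EReal))
    = - ⨅ P : (Fset m n), Phi μ ν P.1 := by
  apply le_antisymm
  · refine iSup_le fun ⟨⟨P, π⟩, hP, hπ⟩ => ?_
    rw [EReal.le_neg]
    refine (iInf_le _ ⟨P, hP⟩).trans ?_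
    exact_mod_cast Phi_le_neg_integral_coupling hμ4 hν4 P hπ
  · rw [EReal.neg_le]
    refine le_iInf fun ⟨P, hP⟩ => ?_
    obtain ⟨π, hπ, hle⟩ := exists_coupling_neg_integral_le_Phi hμ4 hν4 P
    refine le_trans ?_ hle
    rw [EReal.coe_neg, EReal.neg_le_neg_iff]
    exact le_iSup (fun q : {q : Matrix (Fin n) (Fin m) ℝ × Measure ((Fin m → ℝ) × (Fin n → ℝ)) //
      q.1 ∈ Fset m n ∧ IsCoupling q.2 μ ν} =>
      ((∫ z, q.1.1.mulVec z.1 ⬝ᵥ z.2 ∂q.1.2 : ℝ) : EReal)) ⟨(P, π), hP, hπ⟩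

end
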